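/- Every global minimum Roman dominating function of G is a Nash equilibrium of the Roman domination game: if C is a G-RDF, then for every vertex v_i and every c ∈ {0,1,2}, u_i(C) ≥ u_i(c, C_{−i}). -/

import Mathlib

open Finset

section Defs

variable {V : Type*} [Fintype V] [DecidableEq V] (G : SimpleGraph V) [DecidableRel G.Adj]

/-- The closed neighborhood `N̄ᵢ = Nᵢ ∪ {vᵢ}` of a vertex. -/
def closedNbhd (i : V) : Finset V := insert i (G.neighborFinset i)

/-- The graph has no isolated vertices. -/
def noIsolated : Prop := ∀ v : V, ∃ u : V, G.Adj v u

/-- `m_j(C) = 1` if no vertex of `N̄_j` has value 2 under `C`, and `0` otherwise. -/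
def mval (C : V → Fin 3) (j : V) : ℕ :=
  if ∀ k ∈ closedNbhd G j, C k ≠ 2 then 1 else 0

/-- The utility `u_i(C) = -λ1·c_i² - λ2·Σ_{j ∈ N̄ᵢ} (2 - c_j)·m_j(C)`. -/
def util (lam1 lam2 : ℝ) (C : V → Fin 3) (i : V) : ℝ :=
  -lam1 * ((C i : ℕ) : ℝ) ^ 2
    - lam2 * ∑ j ∈ closedNbhd G i, (2 - ((C j : ℕ) : ℝ)) * (mval G C j : ℝ)

/-- The potential function `π(C) = -λ1·Σ_j c_j² - λ2·Σ_j (2 - c_j)·m_j(C)`. -/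
def pot (lam1 lam2 : ℝ) (C : V → Fin 3) : ℝ :=
  -lam1 * ∑ j : V, ((C j : ℕ) : ℝ) ^ 2
    - lam2 * ∑ j : V, (2 - ((C j : ℕ) : ℝ)) * (mval G C j : ℝ)

/-- `C` is a Nash equilibrium: no unilateral deviation strictly improves a player's utility. -/
def isNE (lam1 lam2 : ℝ) (C : V → Fin 3) : Prop :=
  ∀ (i : V) (c : Fin 3),
    util G lam1 lam2 (Function.update C i c) i ≤ util G lam1 lam2 C i

/-- `C` is a Roman dominating function. -/
def isRDF (C : V → Fin 3) : Prop :=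
  ∀ v : V, C v = 0 → ∃ u : V, G.Adj v u ∧ C u = 2

/-- The weight `γ_R(G,C) = Σ_v C(v)`. -/
def weight (C : V → Fin 3) : ℕ := ∑ v : V, (C v : ℕ)

/-- Decrease a value in `{0,1,2}` by one (truncated at 0). -/
def decr (c : Fin 3) : Fin 3 := ⟨c.val - 1, lt_of_le_of_lt (Nat.sub_le _ _) c.isLt⟩

/-- `C` is a minimal RDF. -/
def isMRDF (C : V → Fin 3) : Prop :=
  isRDF G C ∧ ∀ i : V, 1 ≤ (C i : ℕ) → ¬ isRDF G (Function.update C i (decr (C i)))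

/-- `C` is a strongly minimal RDF. -/
def isSRDF (C : V → Fin 3) : Prop :=
  isMRDF G C ∧
    ¬ ∃ (C' : V → Fin 3) (i : V), isRDF G C' ∧ weight C' < weight C ∧
      C' i = 2 ∧ (∀ j : V, G.Adj i j → C j = 1 → C' j = 0) ∧
      (∀ k : V, k ≠ i → ¬(G.Adj i k ∧ C k = 1) → C' k = C k)

/-- `C` is a global minimum RDF. -/
def isGRDF (C : V → Fin 3) : Prop :=
  isRDF G C ∧ ∀ C' : V → Fin 3, isRDF G C' → weight C ≤ weight C'

/-- `Ñ_j(C)`: white neighbors of `v_j` for which `v_j` is the unique vertex of their closed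
neighborhood with value 2. -/
def tildeN (C : V → Fin 3) (j : V) : Finset V :=
  (G.neighborFinset j).filter
    (fun k => C k = 0 ∧ C j = 2 ∧ ∀ l ∈ closedNbhd G k, C l = 2 → l = j)

/-- `m_{i,j}(C) = 1` iff `Ñ_j(C) ⊆ N_i`. -/
def mij (C : V → Fin 3) (i j : V) : ℕ :=
  if tildeN G C j ⊆ G.neighborFinset i then 1 else 0

/-- `w_i(C) = Σ_{v_j ∈ N_i, c_j = 1} m_j(C) + 2·Σ_{v_j ∈ N_i, c_j = 2} m_{i,j}(C)`. -/
def wval (C : V → Fin 3) (i : V) : ℕ :=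
  ∑ j ∈ (G.neighborFinset i).filter (fun j => C j = 1), mval G C j
    + 2 * ∑ j ∈ (G.neighborFinset i).filter (fun j => C j = 2), mij G C i j

/-- The coalition `τ_i` of the private contract proposed by `v_i`. -/
def coalition (C : V → Fin 3) (i : V) : Finset V :=
  insert i ((G.neighborFinset i).filter
    (fun j => C j = 1 ∨ (C j = 2 ∧ mij G C i j = 1)))

/-- The contract profile: `v_i` takes value 2, the other coalition members take value 0. -/
def contract (C : V → Fin 3) (i : V) : V → Fin 3 :=
  fun k => if k = i then 2 else if k ∈ coalition G C i then 0 else C k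

end Defs

section RomanGame

variable {V : Type*} [Fintype V] [DecidableEq V] {G : SimpleGraph V} [DecidableRel G.Adj]

lemma mem_closedNbhd {i j : V} : j ∈ closedNbhd G i ↔ j = i ∨ G.Adj i j := by
  simp [closedNbhd]

lemma mval_eq_one_iff {C : V → Fin 3} {j : V} :
    mval G C j = 1 ↔ C j ≠ 2 ∧ ∀ k, G.Adj j k → C k ≠ 2 := by
  simp [mval, mem_closedNbhd]

lemma mval_eq_zero_iff {C : V → Fin 3} {j : V} :
    mval G C j = 0 ↔ C j = 2 ∨ ∃ k, G.Adj j k ∧ C k = 2 := by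
  simp [mval, mem_closedNbhd]
  exact or_iff_not_imp_left.symm

lemma mval_eq_zero_or_one (C : V → Fin 3) (j : V) : mval G C j = 0 ∨ mval G C j = 1 := by
  unfold mval
  split_ifs <;> simp

lemma mval_update {C : V → Fin 3} {i : V} {c : Fin 3} (hi : C i ≠ 2) (hc : c ≠ 2) (j : V) :
    mval G (Function.update C i c) j = mval G C j := by
  have h : ∀ k, Function.update C i c k ≠ 2 ↔ C k ≠ 2 := by
    intro k
    by_cases hk : k = i
    · subst hk
      simp [hi, hc]
    · simp [hk]
  simp only [mval, h]

lemma fin_three_val_le (c : Fin 3) : ((c : ℕ) : ℝ) ≤ 2 := by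
  exact_mod_cast Nat.le_of_lt_succ c.isLt

lemma deficit_nonneg (C : V → Fin 3) (j : V) :
    0 ≤ (2 - ((C j : ℕ) : ℝ)) * (mval G C j : ℝ) :=
  mul_nonneg (sub_nonneg.2 (fin_three_val_le _)) (Nat.cast_nonneg _)

/-- A player of value 2 dominates its whole closed neighborhood. -/
lemma util_of_eq_two {C : V → Fin 3} {i : V} (lam1 lam2 : ℝ) (hi : C i = 2) :
    util G lam1 lam2 C i = -4 * lam1 := by
  have h : ∑ j ∈ closedNbhd G i, (2 - ((C j : ℕ) : ℝ)) * (mval G C j : ℝ) = 0 := by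
    refine Finset.sum_eq_zero fun j hj => ?_
    have : mval G C j = 0 := by
      rw [mval_eq_zero_iff]
      rcases mem_closedNbhd.1 hj with rfl | hj
      · exact .inl hi
      · exact .inr ⟨i, hj.symm, hi⟩
    simp [this]
  rw [util, h, hi]
  norm_num
  ring

/-- Changing a value between 0 and 1 only affects the summand of the deviating player. -/
lemma sum_deficit_update {C : V → Fin 3} {i : V} {c : Fin 3} (hi : C i ≠ 2) (hc : c ≠ 2) :
    ∑ j ∈ closedNbhd G i, (2 - ((Function.update C i c j : ℕ) : ℝ)) *
        (mval G (Function.update C i c) j : ℝ) =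
      ∑ j ∈ closedNbhd G i, (2 - ((C j : ℕ) : ℝ)) * (mval G C j : ℝ) +
        (((C i : ℕ) : ℝ) - ((c : ℕ) : ℝ)) * (mval G C i : ℝ) := by
  have hmem : i ∉ G.neighborFinset i := by simp
  simp only [mval_update hi hc, closedNbhd, Finset.sum_insert hmem, Function.update_self]
  have : ∑ j ∈ G.neighborFinset i, (2 - ((Function.update C i c j : ℕ) : ℝ)) *
        (mval G C j : ℝ) =
      ∑ j ∈ G.neighborFinset i, (2 - ((C j : ℕ) : ℝ)) * (mval G C j : ℝ) := by
    refine Finset.sum_congr rfl fun j hj => ?_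
    rw [Function.update_of_ne (by rintro rfl; exact hmem hj)]
  rw [this]
  ring

lemma isGRDF.mval_of_eq_one {C : V → Fin 3} (hG : isGRDF G C) {i : V} (hi : C i = 1) :
    mval G C i = 1 := by
  rw [mval_eq_one_iff]
  refine ⟨by simp [hi], fun k hk hk2 => ?_⟩
  have hR : isRDF G (Function.update C i 0) := by
    intro v hv
    by_cases hvi : v = i
    · subst hvi
      exact ⟨k, hk, by rw [Function.update_of_ne hk.ne', hk2]⟩
    · rw [Function.update_of_ne hvi] at hv
      obtain ⟨u, hu, hu2⟩ := hG.1 v hv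
      exact ⟨u, hu, by rw [Function.update_of_ne (by rintro rfl; simp [hi] at hu2), hu2]⟩
  refine absurd (hG.2 _ hR) (not_le.2 ?_)
  refine Finset.sum_lt_sum (fun j _ => ?_) ⟨i, Finset.mem_univ _, by simp [hi]⟩
  by_cases hj : j = i
  · subst hj
    simp
  · simp [hj]

/-- Otherwise playing 2 at `i` and 0 at its neighbors of value 1 would give a lighter RDF. -/
lemma isGRDF.card_one_le_two {C : V → Fin 3} (hG : isGRDF G C) {i : V} (hi : C i ≠ 2) :
    #{j ∈ closedNbhd G i | C j = 1} ≤ 2 := by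
  let D : V → Fin 3 := fun k => if k = i then 2 else if G.Adj i k ∧ C k = 1 then 0 else C k
  have hR : isRDF G D := by
    intro v hv
    by_cases hvi : v = i
    · simp [D, hvi] at hv
    by_cases hv1 : G.Adj i v ∧ C v = 1
    · exact ⟨i, hv1.1.symm, by simp [D]⟩
    · simp only [D, hvi, hv1, if_false] at hv
      obtain ⟨u, hu, hu2⟩ := hG.1 v hv
      exact ⟨u, hu, by simp [D, hu2]⟩
  have hpt : ∀ k, (D k : ℕ) + (if k ∈ closedNbhd G i ∧ C k = 1 then 1 else 0) =
      (C k : ℕ) + (if k = i then 2 else 0) := by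
    intro k
    by_cases hk : k = i
    · subst hk
      generalize hc : C k = c at hi
      fin_cases c <;> simp_all [D, mem_closedNbhd]
    · by_cases h : G.Adj i k ∧ C k = 1
      · simp [D, hk, h, mem_closedNbhd]
      · simp [D, hk, h, mem_closedNbhd]
  have hsum := Finset.sum_congr (rfl : (univ : Finset V) = univ) fun k _ => hpt k
  have hcard : ∑ k, (if k ∈ closedNbhd G i ∧ C k = 1 then 1 else 0) =
      #{j ∈ closedNbhd G i | C j = 1} := by
    rw [Finset.sum_boole, Nat.cast_id]
    congr 1
    ext
    simp
  rw [Finset.sum_add_distrib, Finset.sum_add_distrib, hcard] at hsum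
  have := hG.2 D hR
  simp only [weight] at this
  simp only [Finset.sum_ite_eq', Finset.mem_univ, if_true] at hsum
  omega

lemma isRDF.sum_deficit_le {C : V → Fin 3} (hR : isRDF G C) (i : V) :
    ∑ j ∈ closedNbhd G i, (2 - ((C j : ℕ) : ℝ)) * (mval G C j : ℝ) ≤
      #{j ∈ closedNbhd G i | C j = 1} := by
  rw [Finset.card_filter, Nat.cast_sum]
  refine Finset.sum_le_sum fun j _ => ?_
  rcases mval_eq_zero_or_one (G := G) C j with h | h
  · simp only [h, Nat.cast_zero, mul_zero, Nat.cast_nonneg]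
  · have h2 := (mval_eq_one_iff.1 h).1
    have h0 : C j ≠ 0 := fun h0 => by
      obtain ⟨u, hu, hu2⟩ := hR j h0
      exact (mval_eq_one_iff.1 h).2 u hu hu2
    have h1 : C j = 1 := by
      generalize C j = c at *
      fin_cases c <;> simp_all
    simp [h, h1]
    norm_num

/-- The undominated vertices created by lowering a value 2 in a minimum RDF: otherwise playing 1 on
all of them would give a lighter RDF. -/
lemma isGRDF.two_le_card_undominated {C : V → Fin 3} (hG : isGRDF G C) {i : V} (hi : C i = 2)
    {c : Fin 3} (hc : c ≠ 2) :
    2 ≤ #{j ∈ closedNbhd G i | (j = i ∨ C j = 0) ∧ mval G (Function.update C i c) j = 1} := by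
  set S := {j ∈ closedNbhd G i | (j = i ∨ C j = 0) ∧ mval G (Function.update C i c) j = 1}
    with hS
  let D : V → Fin 3 := fun k => if k ∈ S then 1 else if k = i then 0 else C k
  have hmem : ∀ k ∈ S, k = i ∨ C k = 0 := fun k hk => (Finset.mem_filter.1 hk).2.1
  have hD : ∀ u, u ≠ i → C u = 2 → D u = 2 := by
    intro u hu hu2
    have : u ∉ S := fun h => by simpa [hu, hu2] using hmem u h
    simp [D, this, hu, hu2]
  have hR : isRDF G D := by
    intro v hv
    have hvS : v ∉ S := fun h => by simp [D, h] at hv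
    have hv0 : v = i ∨ C v = 0 := by
      by_contra! h
      simp [D, hvS, h] at hv
    by_cases hvN : v ∈ closedNbhd G i
    · have hm : mval G (Function.update C i c) v = 0 :=
        (mval_eq_zero_or_one _ _).resolve_right fun h =>
          hvS (Finset.mem_filter.2 ⟨hvN, hv0, h⟩)
      have hne : ∀ u, Function.update C i c u = 2 → u ≠ i ∧ C u = 2 := by
        intro u hu
        have hui : u ≠ i := by
          rintro rfl
          exact hc (by simpa using hu)
        exact ⟨hui, by simpa [hui] using hu⟩
      rcases mval_eq_zero_iff.1 hm with h | ⟨k, hk, hk2⟩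
      · obtain ⟨hvi, hv2⟩ := hne v h
        simp [hvi, hv2] at hv0
      · exact ⟨k, hk, hD k (hne k hk2).1 (hne k hk2).2⟩
    · rw [mem_closedNbhd, not_or] at hvN
      obtain ⟨u, hu, hu2⟩ := hG.1 v (hv0.resolve_left hvN.1)
      exact ⟨u, hu, hD u (by rintro rfl; exact hvN.2 hu.symm) hu2⟩
  have hpt : ∀ k, (D k : ℕ) + (if k = i then 2 else 0) =
      (C k : ℕ) + (if k ∈ S then 1 else 0) := by
    intro k
    by_cases hk : k = i
    · subst hk
      by_cases h : k ∈ S <;> simp [D, h, hi]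
    · by_cases h : k ∈ S
      · simp [D, h, hk, (hmem k h).resolve_left hk]
      · simp [D, h, hk]
  have hsum := Finset.sum_congr (rfl : (univ : Finset V) = univ) fun k _ => hpt k
  rw [Finset.sum_add_distrib, Finset.sum_add_distrib] at hsum
  have := hG.2 D hR
  simp only [weight] at this
  simp only [Finset.sum_ite_eq', Finset.sum_ite_mem, Finset.univ_inter, Finset.mem_univ, if_true,
    Finset.sum_const, smul_eq_mul, mul_one] at hsum
  omega

lemma isGRDF.le_sum_deficit_update {C : V → Fin 3} (hG : isGRDF G C) {i : V} (hi : C i = 2)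
    {c : Fin 3} (hc : c ≠ 2) :
    4 - ((c : ℕ) : ℝ) ≤ ∑ j ∈ closedNbhd G i, (2 - ((Function.update C i c j : ℕ) : ℝ)) *
        (mval G (Function.update C i c) j : ℝ) := by
  have hcard := hG.two_le_card_undominated hi hc
  set S := {j ∈ closedNbhd G i | (j = i ∨ C j = 0) ∧ mval G (Function.update C i c) j = 1}
  have hsub := Finset.sum_le_sum_of_subset_of_nonneg
    (Finset.filter_subset _ _ : S ⊆ closedNbhd G i)
    (fun j _ _ => deficit_nonneg (G := G) (Function.update C i c) j)
  refine le_trans ?_ hsub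
  have hterm : ∀ j ∈ S, (2 - ((Function.update C i c j : ℕ) : ℝ)) *
      (mval G (Function.update C i c) j : ℝ) = 2 - (if j = i then ((c : ℕ) : ℝ) else 0) := by
    intro j hj
    obtain ⟨-, hj0, hjm⟩ := Finset.mem_filter.1 hj
    by_cases hji : j = i
    · subst hji
      simp [hjm]
    · simp [hjm, hji, hj0.resolve_left hji]
  rw [Finset.sum_congr rfl hterm, Finset.sum_sub_distrib, Finset.sum_ite_eq', Finset.sum_const,
    nsmul_eq_mul]
  have hcard' : (2 : ℝ) ≤ #S := by exact_mod_cast hcard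
  have hc0 : (0 : ℝ) ≤ ((c : ℕ) : ℝ) := Nat.cast_nonneg _
  split_ifs <;> linarith

end RomanGame

/-- Every global minimum RDF of G is a Nash equilibrium of the Roman domination
game. -/
theorem stmt9 {V : Type*} [Fintype V] [DecidableEq V] (G : SimpleGraph V)
    [DecidableRel G.Adj] (lam1 lam2 : ℝ)
    (h1 : 0 < 2 / 3 * lam2) (h2 : 2 / 3 * lam2 < lam1) (h3 : lam1 < 3 / 4 * lam2)
    (hiso : noIsolated G)
    (C : V → Fin 3) (hG : isGRDF G C) :
    isNE G lam1 lam2 C := by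
  intro i c
  by_cases hi : C i = 2
  · rw [util_of_eq_two lam1 lam2 hi]
    by_cases hc : c = 2
    · rw [util_of_eq_two lam1 lam2 (by simp [hc])]
    have hS := hG.le_sum_deficit_update hi hc
    rw [util, Function.update_self]
    have := mul_le_mul_of_nonneg_left hS (by linarith : 0 ≤ lam2)
    fin_cases c
    · norm_num at *
      linarith
    · norm_num at *
      linarith
    · exact absurd rfl hc
  have hS : ∑ j ∈ closedNbhd G i, (2 - ((C j : ℕ) : ℝ)) * (mval G C j : ℝ) ≤ 2 :=
    (hG.1.sum_deficit_le i).trans (by exact_mod_cast hG.card_one_le_two hi)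
  have hmul := mul_le_mul_of_nonneg_left hS (by linarith : 0 ≤ lam2)
  have hi01 : C i = 0 ∨ C i = 1 := by
    generalize C i = d at *
    fin_cases d <;> simp_all
  by_cases hc : c = 2
  · rw [util_of_eq_two lam1 lam2 (by simp [hc]), util]
    rcases hi01 with h | h <;> rw [h] <;> norm_num <;> linarith
  rw [util, util, sum_deficit_update hi hc, Function.update_self]
  have hc01 : c = 0 ∨ c = 1 := by
    fin_cases c <;> simp_all
  rcases hi01 with h | h
  · have hm : mval G C i = 0 := mval_eq_zero_iff.2 (.inr (hG.1 i h))
    rcases hc01 with rfl | rfl <;> rw [h, hm] <;> norm_num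
    linarith
  · have hm : mval G C i = 1 := hG.mval_of_eq_one h
    rcases hc01 with rfl | rfl <;> rw [h, hm] <;> norm_num
    linarith
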